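/- The set { s₂(n)/s₃(n) : n a positive integer } is dense in the positive real numbers: for every real x > 0 and every ε > 0 there exists a positive integer n with | s₂(n)/s₃(n) − x | < ε. -/

import Mathlib

/-- Sum of digits of `n` in base `q`. -/
def digitSum (q n : ℕ) : ℕ := (Nat.digits q n).sum


open Finset in
lemma ds_rec {q : ℕ} (hq : 2 ≤ q) (n : ℕ) : digitSum q n = n % q + digitSum q (n / q) := by
  unfold digitSum
  rcases Nat.eq_zero_or_pos n with rfl | hn
  · simp
  · rw [Nat.digits_def' hq hn]; simp

lemma ds_zero (q : ℕ) : digitSum q 0 = 0 := by simp [digitSum]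

lemma ds_cons {q : ℕ} (hq : 2 ≤ q) {a : ℕ} (ha : a < q) (b : ℕ) :
    digitSum q (a + q * b) = a + digitSum q b := by
  rw [ds_rec hq, Nat.add_mul_mod_self_left, Nat.mod_eq_of_lt ha,
    Nat.add_mul_div_left _ _ (by omega), Nat.div_eq_of_lt ha, zero_add]

lemma ds_add {q : ℕ} (hq : 2 ≤ q) (m : ℕ) : ∀ a b : ℕ, a < q ^ m →
    digitSum q (a + q ^ m * b) = digitSum q a + digitSum q b := by
  induction m with
  | zero => intro a b ha; simp at ha; simp [ha, ds_zero]
  | succ m ih =>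
    intro a b ha
    have h1 : a + q ^ (m + 1) * b = a % q + q * (a / q + q ^ m * b) := by
      have := Nat.mod_add_div a q
      calc a + q ^ (m + 1) * b = (a % q + q * (a / q)) + q ^ (m + 1) * b := by rw [this]
        _ = _ := by ring
    rw [h1, ds_cons hq (Nat.mod_lt _ (by omega)), ih, ds_rec hq a, add_assoc]
    rw [Nat.div_lt_iff_lt_mul (by omega)]; rwa [pow_succ] at ha

lemma ds_floor {q : ℕ} (hq : 2 ≤ q) (D : ℕ) : ∀ n : ℕ, n < q ^ D →
    digitSum q n + (q - 1) * ∑ d ∈ Finset.range D, n / q ^ (d + 1) = n := by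
  induction D with
  | zero => intro n hn; simp at hn; simp [hn, ds_zero]
  | succ D ih =>
    intro n hn
    have h1 := ih (n / q) (by rw [Nat.div_lt_iff_lt_mul (by omega)]; rwa [pow_succ] at hn)
    have h2 : ∑ d ∈ Finset.range D, n / q ^ (d + 1 + 1) =
        ∑ d ∈ Finset.range D, (n / q) / q ^ (d + 1) := by
      refine Finset.sum_congr rfl fun d _ => ?_
      rw [Nat.div_div_eq_div_mul, ← pow_succ']
    rw [Finset.sum_range_succ', h2, ds_rec hq]
    have h3 := Nat.mod_add_div n q
    obtain ⟨r, rfl⟩ : ∃ r, q = r + 1 := ⟨q - 1, by omega⟩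
    simp only [zero_add, pow_one, Nat.add_sub_cancel] at *
    nlinarith

lemma ds_fract {q : ℕ} (hq : 2 ≤ q) (D n : ℕ) (hn : n < q ^ D) :
    (digitSum q n : ℝ) = n / (q : ℝ) ^ D +
      ((q : ℝ) - 1) * ∑ d ∈ Finset.range D, Int.fract ((n : ℝ) / (q : ℝ) ^ (d + 1)) := by
  have h := ds_floor hq D n hn
  have h' : (digitSum q n : ℝ) + ((q : ℝ) - 1) * ∑ d ∈ Finset.range D, ((n / q ^ (d + 1) : ℕ) : ℝ)
      = n := by
    have : ((q - 1 : ℕ) : ℝ) = (q : ℝ) - 1 := by rw [Nat.cast_sub (by omega)]; simp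
    rw [← this]; exact_mod_cast h
  have hf : ∀ d, Int.fract ((n : ℝ) / (q : ℝ) ^ (d + 1)) =
      (n : ℝ) / (q : ℝ) ^ (d + 1) - ((n / q ^ (d + 1) : ℕ) : ℝ) := by
    intro d
    rw [Int.fract]
    congr 1
    have := Nat.floor_div_eq_div (K := ℝ) n (q ^ (d + 1))
    rw [← this]
    push_cast
    rw [← natCast_floor_eq_intCast_floor (by positivity)]
  have hg : ∀ D : ℕ, ((q : ℝ) - 1) * ∑ d ∈ Finset.range D, (n : ℝ) / (q : ℝ) ^ (d + 1) =
      n - n / (q : ℝ) ^ D := by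
    intro D
    have hq0 : (q : ℝ) ≠ 0 := by positivity
    induction D with
    | zero => simp
    | succ D ih =>
      rw [Finset.sum_range_succ, mul_add, ih]
      field_simp
      ring
  simp only [hf, Finset.sum_sub_distrib, mul_sub, hg]
  linarith

lemma ds_rep {p : ℕ} (hp : 2 ≤ p) (m : ℕ) :
    digitSum p (∑ i ∈ Finset.range m, p ^ i) = m ∧ ∑ i ∈ Finset.range m, p ^ i < p ^ m := by
  induction m with
  | zero => simp [ds_zero]
  | succ m ih =>
    rw [Finset.sum_range_succ]
    constructor
    · have := ds_add hp m _ 1 ih.2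
      rw [mul_one] at this
      rw [this, ih.1]
      have h1 := ds_cons hp (a := 1) (by omega) 0
      simp [ds_zero] at h1
      rw [h1]
    · rw [pow_succ]; linarith [ih.2, Nat.mul_le_mul_left (p ^ m) hp]

/-- the fixed part of one cell -/
def cellF (p k : ℕ) : ℕ := 1 + p * (p * ∑ i ∈ Finset.range (k - 1), p ^ i)

lemma cell_prop {p k r : ℕ} (hp : 2 ≤ p) (hk : 1 ≤ k) (hkr : k < r) (b : Prop) [Decidable b] :
    digitSum p (cellF p k + if b then p - 1 else 0) = k ∧
    (cellF p k + if b then p - 1 else 0) < p ^ r := by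
  have hR := ds_rep hp (k - 1)
  set R := ∑ i ∈ Finset.range (k - 1), p ^ i with hRd
  have h0 : digitSum p (p * R) = k - 1 := by
    have := ds_cons hp (a := 0) (by omega) R
    rw [zero_add, zero_add, hR.1] at this; exact this
  have hle : cellF p k + (p - 1) < p ^ r := by
    have h1 : cellF p k + (p - 1) = p * (1 + p * R) := by
      unfold cellF; rw [← hRd]
      obtain ⟨s, rfl⟩ : ∃ s, p = s + 1 := ⟨p - 1, by omega⟩
      simp; ring
    have h2 : p ^ (k - 1 + 1 + 1) ≤ p ^ r := Nat.pow_le_pow_right (by omega) (by omega)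
    have h3 : p ^ (k - 1 + 1 + 1) = p * (p * p ^ (k - 1)) := by ring
    have h4 : 1 + p * R < p * p ^ (k - 1) := by nlinarith [hR.2]
    rw [h1]
    calc p * (1 + p * R) < p * (p * p ^ (k - 1)) := by
          apply Nat.mul_lt_mul_of_pos_left h4 (by omega)
      _ ≤ _ := by omega
  split_ifs
  · refine ⟨?_, hle⟩
    have h1 : cellF p k + (p - 1) = 0 + p * (1 + p * R) := by
      unfold cellF; rw [← hRd]
      obtain ⟨s, rfl⟩ : ∃ s, p = s + 1 := ⟨p - 1, by omega⟩
      simp; ring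
    rw [h1, ds_cons hp (by omega), ds_cons hp (by omega), hR.1]; omega
  · refine ⟨?_, by omega⟩
    unfold cellF
    rw [← hRd, add_zero, ds_cons hp (by omega), h0]; omega

/-- the numbers under consideration -/
def nB (P f g C : ℕ) (B : Finset ℕ) : ℕ :=
  ∑ c ∈ Finset.range C, P ^ c * (f + if c ∈ B then g else 0)

lemma nB_prop {p k r : ℕ} (hp : 2 ≤ p) (hk : 1 ≤ k) (hkr : k < r) (C : ℕ) (B : Finset ℕ) :
    digitSum p (nB (p ^ r) (cellF p k) (p - 1) C B) = k * C ∧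
    nB (p ^ r) (cellF p k) (p - 1) C B < (p ^ r) ^ C := by
  induction C with
  | zero => simp [nB, ds_zero]
  | succ C ih =>
    have hc := cell_prop hp hk hkr (C ∈ B)
    have hs : nB (p ^ r) (cellF p k) (p - 1) (C + 1) B = nB (p ^ r) (cellF p k) (p - 1) C B +
        (p ^ r) ^ C * (cellF p k + if C ∈ B then p - 1 else 0) := by
      unfold nB; rw [Finset.sum_range_succ]
    rw [hs]
    constructor
    · have := ds_add hp (r * C) (nB (p ^ r) (cellF p k) (p - 1) C B)
        (cellF p k + if C ∈ B then p - 1 else 0) (by rw [pow_mul]; exact ih.2)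
      rw [pow_mul] at this
      rw [this, ih.1, hc.1]; ring
    · rw [pow_succ]; nlinarith [ih.2, hc.2]

open Real in
lemma beta_hasSum (x : ℝ) : HasSum (fun n : ℕ => 1 / (n : ℝ) ^ 2 * Real.cos (2 * π * n * x))
    (π ^ 2 * (Int.fract x ^ 2 - Int.fract x + 6⁻¹)) := by
  have h := hasSum_one_div_nat_pow_mul_cos (k := 1) one_ne_zero (x := Int.fract x)
    ⟨Int.fract_nonneg x, (Int.fract_lt_one x).le⟩
  have h2 := bernoulliFun_two (Int.fract x)
  unfold bernoulliFun at h2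
  simp only [mul_one] at h
  rw [h2] at h
  convert h using 1
  · funext n
    congr 1
    have : 2 * π * n * Int.fract x = 2 * π * n * x - ((n * ⌊x⌋ : ℤ) : ℝ) * (2 * π) := by
      rw [Int.fract]; push_cast; ring
    rw [this, Real.cos_sub_int_mul_two_pi]
  · have : ((Nat.factorial 2 : ℕ) : ℝ) = 2 := by norm_num [Nat.factorial]
    rw [this]; ring

open Real in
lemma beta_avg (ε : ℝ) (hε : 0 < ε) : ∃ H : ℕ, ∃ κ : ℝ, 0 < κ ∧
    ∀ (s : Finset (Finset ℕ)) (X : Finset ℕ → ℝ),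
      (∀ h : ℕ, 1 ≤ h → h ≤ H →
        ‖∑ i ∈ s, Complex.exp (((2 * π * h * X i : ℝ) : ℂ) * Complex.I)‖ ≤ κ * s.card) →
      ∀ t : ℝ, |∑ i ∈ s, (Int.fract (X i + t) ^ 2 - Int.fract (X i + t) + 6⁻¹)| ≤ ε * s.card := by
  have hsum : Summable (fun n : ℕ => 1 / (n : ℝ) ^ 2) := Real.summable_one_div_nat_pow.2 (by norm_num)
  set S := ∑' n : ℕ, 1 / (n : ℝ) ^ 2 with hS
  have hS0 : 0 ≤ S := tsum_nonneg fun n => by positivity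
  obtain ⟨H, hH⟩ := ((tendsto_sum_nat_add (fun n : ℕ => 1 / (n : ℝ) ^ 2)).eventually
    (gt_mem_nhds hε)).exists
  refine ⟨H, ε / (S + 1), by positivity, ?_⟩
  intro s X hX t
  have hcos : ∀ n : ℕ, |∑ i ∈ s, Real.cos (2 * π * n * (X i + t))| ≤
      ‖∑ i ∈ s, Complex.exp (((2 * π * n * X i : ℝ) : ℂ) * Complex.I)‖ := by
    intro n
    have h1 : ∑ i ∈ s, Real.cos (2 * π * n * (X i + t)) =
        (Complex.exp (((2 * π * n * t : ℝ) : ℂ) * Complex.I) *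
          ∑ i ∈ s, Complex.exp (((2 * π * n * X i : ℝ) : ℂ) * Complex.I)).re := by
      rw [Finset.mul_sum, Complex.re_sum]
      refine Finset.sum_congr rfl fun i _ => ?_
      rw [← Complex.exp_add, ← add_mul, ← Complex.ofReal_add, Complex.exp_ofReal_mul_I_re]
      congr 1; ring
    rw [h1]
    refine (Complex.abs_re_le_norm _).trans ?_
    rw [norm_mul, Complex.norm_exp_ofReal_mul_I, one_mul]
  have hs : HasSum (fun n : ℕ => 1 / (n : ℝ) ^ 2 * ∑ i ∈ s, Real.cos (2 * π * n * (X i + t)))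
      (∑ i ∈ s, π ^ 2 * (Int.fract (X i + t) ^ 2 - Int.fract (X i + t) + 6⁻¹)) := by
    have := hasSum_sum (s := s) fun i _ => beta_hasSum (X i + t)
    simpa only [Finset.mul_sum] using this
  set a : ℕ → ℝ := fun n => 1 / (n : ℝ) ^ 2 * ∑ i ∈ s, Real.cos (2 * π * n * (X i + t)) with ha
  have htriv : ∀ n, |a n| ≤ 1 / (n : ℝ) ^ 2 * s.card := by
    intro n
    rw [ha]; simp only
    rw [abs_mul, abs_of_nonneg (by positivity : (0 : ℝ) ≤ 1 / (n : ℝ) ^ 2)]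
    gcongr
    refine (Finset.abs_sum_le_sum_abs _ _).trans ?_
    refine (Finset.sum_le_card_nsmul _ _ 1 fun i _ => Real.abs_cos_le_one _).trans ?_
    simp
  have hsmall : ∀ n < H, |a n| ≤ 1 / (n : ℝ) ^ 2 * (ε / (S + 1) * s.card) := by
    intro n hn
    rcases Nat.eq_zero_or_pos n with rfl | h0
    · simp [ha]
    rw [ha]; simp only
    rw [abs_mul, abs_of_nonneg (by positivity : (0 : ℝ) ≤ 1 / (n : ℝ) ^ 2)]
    gcongr
    exact (hcos n).trans (hX n h0 hn.le)
  have hsplit := hs.summable.sum_add_tsum_nat_add H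
  rw [hs.tsum_eq] at hsplit
  have h1 : |∑ n ∈ Finset.range H, a n| ≤ S * (ε / (S + 1) * s.card) := by
    refine (Finset.abs_sum_le_sum_abs _ _).trans ?_
    refine (Finset.sum_le_sum fun n hn => hsmall n (Finset.mem_range.1 hn)).trans ?_
    rw [← Finset.sum_mul]
    gcongr
    exact hsum.sum_le_tsum _ fun n _ => by positivity
  have h2 : |∑' n, a (n + H)| ≤ ε * s.card := by
    have hb : HasSum (fun n : ℕ => 1 / ((n + H : ℕ) : ℝ) ^ 2 * (s.card : ℝ))
        ((∑' n : ℕ, 1 / ((n + H : ℕ) : ℝ) ^ 2) * (s.card : ℝ)) :=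
      ((summable_nat_add_iff H).2 hsum).hasSum.mul_right _
    have := tsum_of_norm_bounded (f := fun n => a (n + H)) hb fun n => htriv (n + H)
    rw [Real.norm_eq_abs] at this
    refine this.trans ?_
    gcongr
  have h3 : S * (ε / (S + 1) * s.card) ≤ ε * s.card := by
    rw [← mul_assoc]; gcongr
    rw [mul_div_assoc', div_le_iff₀ (by positivity)]; nlinarith
  rw [← Finset.mul_sum] at hsplit
  have h4 : |π ^ 2 * ∑ i ∈ s, (Int.fract (X i + t) ^ 2 - Int.fract (X i + t) + 6⁻¹)| ≤
      2 * (ε * s.card) := by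
    rw [← hsplit]
    refine (abs_add_le _ _).trans ?_
    linarith
  rw [abs_mul, abs_of_nonneg (by positivity : (0 : ℝ) ≤ π ^ 2)] at h4
  have : 2 ≤ π ^ 2 := by nlinarith [Real.pi_gt_three]
  have h0 : 0 ≤ |∑ i ∈ s, (Int.fract (X i + t) ^ 2 - Int.fract (X i + t) + 6⁻¹)| := abs_nonneg _
  nlinarith

lemma fract_add_cases (x δ : ℝ) (h0 : 0 < δ) (h1 : δ < 1) :
    (Int.fract (x + δ) = Int.fract x + δ ∧ Int.fract x + δ < 1) ∨
    (Int.fract (x + δ) = Int.fract x + δ - 1 ∧ 1 ≤ Int.fract x + δ) := by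
  have ha := Int.fract_nonneg x
  have hb := Int.fract_lt_one x
  have hx := Int.floor_add_fract x
  rcases lt_or_ge (Int.fract x + δ) 1 with h | h
  · left
    refine ⟨?_, h⟩
    rw [Int.fract_eq_iff]
    exact ⟨by linarith, h, ⌊x⌋, by linarith⟩
  · right
    refine ⟨?_, h⟩
    rw [Int.fract_eq_iff]
    exact ⟨by linarith, by linarith, ⌊x⌋ + 1, by push_cast; linarith⟩

lemma saw_lower (x δ : ℝ) (h0 : 0 < δ) (h1 : δ < 1) :
    (Int.fract (x + δ) ^ 2 - Int.fract (x + δ) + 6⁻¹) - (Int.fract (x + 0) ^ 2 - Int.fract (x + 0) + 6⁻¹)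
      - δ ^ 2 ≤ 2 * δ * (Int.fract x - 1 / 2) := by
  rw [add_zero]
  rcases fract_add_cases x δ h0 h1 with ⟨h, h'⟩ | ⟨h, h'⟩ <;> rw [h] <;> nlinarith

lemma saw_upper (x δ : ℝ) (h0 : 0 < δ) (h1 : δ < 1) :
    2 * δ * (Int.fract x - 1 / 2) ≤
    (Int.fract (x + 0) ^ 2 - Int.fract (x + 0) + 6⁻¹) -
      (Int.fract (x + -δ) ^ 2 - Int.fract (x + -δ) + 6⁻¹) + δ ^ 2 := by
  rw [add_zero]
  have hlt := Int.fract_lt_one (x + -δ)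
  rcases fract_add_cases (x + -δ) δ h0 h1 with ⟨h, h'⟩ | ⟨h, h'⟩ <;>
    rw [neg_add_cancel_right] at h <;> rw [h] <;> nlinarith

open Real in
lemma saw_avg (ε : ℝ) (hε : 0 < ε) : ∃ H : ℕ, ∃ κ : ℝ, 0 < κ ∧
    ∀ (s : Finset (Finset ℕ)) (X : Finset ℕ → ℝ),
      (∀ h : ℕ, 1 ≤ h → h ≤ H →
        ‖∑ i ∈ s, Complex.exp (((2 * π * h * X i : ℝ) : ℂ) * Complex.I)‖ ≤ κ * s.card) →
      |∑ i ∈ s, (Int.fract (X i) - 1 / 2)| ≤ ε * s.card := by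
  obtain ⟨δ, hδ0, hδ1, hδε⟩ : ∃ δ : ℝ, 0 < δ ∧ δ < 1 ∧ δ ≤ ε :=
    ⟨min ε (1 / 2), by positivity, by
      have := min_le_right ε (1 / 2); linarith, min_le_left _ _⟩
  obtain ⟨H, κ, hκ, hH⟩ := beta_avg (δ * ε / 2) (by positivity)
  refine ⟨H, κ, hκ, fun s X hX => ?_⟩
  have hb := hH s X hX
  have e1 := abs_le.1 (hb 0)
  have e2 := abs_le.1 (hb δ)
  have e3 := abs_le.1 (hb (-δ))
  have l := Finset.sum_le_sum fun i (_ : i ∈ s) => saw_lower (X i) δ hδ0 hδ1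
  have u := Finset.sum_le_sum fun i (_ : i ∈ s) => saw_upper (X i) δ hδ0 hδ1
  rw [Finset.sum_sub_distrib, Finset.sum_sub_distrib, ← Finset.mul_sum] at l
  rw [Finset.sum_add_distrib, Finset.sum_sub_distrib, ← Finset.mul_sum] at u
  simp only [Finset.sum_const, nsmul_eq_mul] at l u
  have hc : (0 : ℝ) ≤ s.card := Nat.cast_nonneg _
  have h2 : (s.card : ℝ) * δ ^ 2 ≤ δ * (ε * s.card) := by nlinarith [mul_nonneg hc hδ0.le]
  rw [abs_le]
  constructor
  · refine le_of_mul_le_mul_left ?_ (by positivity : 0 < 2 * δ)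
    linarith [e1.1, e1.2, e2.1, e2.2]
  · refine le_of_mul_le_mul_left ?_ (by positivity : 0 < 2 * δ)
    linarith [e1.1, e1.2, e3.1, e3.2]

lemma round_run {P : ℕ} (hP : 2 ≤ P) (z : ℝ) (R : ℕ) (hR : 1 ≤ R)
    (h : ∀ i < R, |z * (P : ℝ) ^ i - round (z * (P : ℝ) ^ i)| < 1 / (2 * P)) :
    |z - round z| * (P : ℝ) ^ R < 1 / 2 := by
  have hP0 : (0 : ℝ) < P := by positivity
  induction R, hR using Nat.le_induction with
  | base =>
    have := h 0 (by norm_num)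
    rw [pow_zero, mul_one, lt_div_iff₀ (by positivity)] at this
    rw [pow_one]; linarith
  | succ R hR ih =>
    have h1 := ih fun i hi => h i (by omega)
    have h2 := h R (by omega)
    have h3 : |z * (P : ℝ) ^ R - ((round z * (P : ℤ) ^ R : ℤ) : ℝ)| < 1 / 2 := by
      push_cast
      rw [← sub_mul, abs_mul, abs_of_pos (by positivity : (0 : ℝ) < (P : ℝ) ^ R)]
      exact h1
    have h4 : round (z * (P : ℝ) ^ R) = round z * (P : ℤ) ^ R := by
      have a1 := abs_sub_round (z * (P : ℝ) ^ R)
      have : |((round (z * (P : ℝ) ^ R) - round z * (P : ℤ) ^ R : ℤ) : ℝ)| < 1 := by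
        rw [Int.cast_sub]
        rw [abs_lt] at *
        rw [abs_le] at a1
        constructor <;> linarith [a1.1, a1.2, h3.1, h3.2]
      have : |round (z * (P : ℝ) ^ R) - round z * (P : ℤ) ^ R| < 1 := by exact_mod_cast this
      have := Int.abs_lt_one_iff.1 this
      omega
    rw [h4] at h2
    push_cast at h2
    rw [← sub_mul, abs_mul, abs_of_pos (by positivity : (0 : ℝ) < (P : ℝ) ^ R),
      lt_div_iff₀ (by positivity)] at h2
    rw [pow_succ]; linarith

lemma clog_facts {P q : ℕ} (hP : 2 ≤ P) (hq : 2 ≤ q) (d : ℕ) :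
    q ^ d ≤ P ^ Nat.clog P (q ^ d) ∧ P ^ Nat.clog P (q ^ d) ≤ P * q ^ d := by
  refine ⟨Nat.le_pow_clog (by omega) _, ?_⟩
  rcases Nat.eq_zero_or_pos d with rfl | hd
  · simp; omega
  have h1 : 1 < q ^ d := Nat.one_lt_pow (by omega) (by omega)
  have h2 := Nat.pow_pred_clog_lt_self (b := P) (by omega) h1
  have h3 : 0 < Nat.clog P (q ^ d) := Nat.clog_pos (by omega) h1
  obtain ⟨c, hc⟩ : ∃ c, Nat.clog P (q ^ d) = c + 1 := ⟨_, (Nat.succ_pred_eq_of_pos h3).symm⟩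
  rw [hc] at h2 ⊢
  rw [Nat.pred_succ] at h2
  rw [pow_succ, mul_comm]
  exact Nat.mul_le_mul_left _ h2.le

/-- the relevant phase -/
noncomputable def ph (P q g h d c : ℕ) : ℝ := (h : ℝ) * ((g : ℝ) * (P : ℝ) ^ c / (q : ℝ) ^ d)

/-- phase is far from integers -/
def far (P q g h d c : ℕ) : Prop := 1 / (2 * (P : ℝ)) ≤ |ph P q g h d c - round (ph P q g h d c)|

lemma ph_bounds {P q g h : ℕ} (hP : 2 ≤ P) (hq : 2 ≤ q) (hg : 1 ≤ g) (hh : 1 ≤ h) (d t : ℕ) :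
    1 ≤ ph P q g h d (Nat.clog P (q ^ d) + t) ∧
    ph P q g h d (Nat.clog P (q ^ d) + t) ≤ ((h * g * P ^ (t + 1) : ℕ) : ℝ) := by
  obtain ⟨h1, h2⟩ := clog_facts hP hq d
  set c := Nat.clog P (q ^ d)
  have h1' : (q : ℝ) ^ d ≤ (P : ℝ) ^ c := by exact_mod_cast h1
  have h2' : (P : ℝ) ^ c ≤ P * (q : ℝ) ^ d := by exact_mod_cast h2
  have hq0 : (0 : ℝ) < (q : ℝ) ^ d := by positivity
  have hPt : (1 : ℝ) ≤ (P : ℝ) ^ t := one_le_pow₀ (by exact_mod_cast (by omega : 1 ≤ P))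
  have hg' : (1 : ℝ) ≤ g := by exact_mod_cast hg
  have hh' : (1 : ℝ) ≤ h := by exact_mod_cast hh
  have e : ph P q g h d (c + t) = (h * g * (P : ℝ) ^ t) * ((P : ℝ) ^ c / (q : ℝ) ^ d) := by
    unfold ph; rw [pow_add]; ring
  have r1 : 1 ≤ (P : ℝ) ^ c / (q : ℝ) ^ d := by rwa [le_div_iff₀ hq0, one_mul]
  have r2 : (P : ℝ) ^ c / (q : ℝ) ^ d ≤ P := by rwa [div_le_iff₀ hq0]
  rw [e]
  constructor
  · have : (1 : ℝ) ≤ h * g := one_le_mul_of_one_le_of_one_le hh' hg'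
    exact one_le_mul_of_one_le_of_one_le (one_le_mul_of_one_le_of_one_le this hPt) r1
  · push_cast
    rw [pow_succ, ← mul_assoc]
    gcongr

lemma sep {P q g h : ℕ} (hP : 2 ≤ P) (hq : 2 ≤ q) (hc : Nat.Coprime P q) (hg : 1 ≤ g) (hh : 1 ≤ h)
    (t R J d d' : ℕ) (hR : (1 + P) * q ^ J ≤ P ^ R) (hd : d < d') (hJ : d' ≤ d + J)
    (n1 : |ph P q g h d (Nat.clog P (q ^ d) + t) - round (ph P q g h d (Nat.clog P (q ^ d) + t))|
      * (P : ℝ) ^ R < 1 / 2)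
    (n2 : |ph P q g h d' (Nat.clog P (q ^ d') + t) - round (ph P q g h d' (Nat.clog P (q ^ d') + t))|
      * (P : ℝ) ^ R < 1 / 2)
    (heq : round (ph P q g h d (Nat.clog P (q ^ d) + t)) =
      round (ph P q g h d' (Nat.clog P (q ^ d') + t))) : False := by
  obtain ⟨b1, -⟩ := ph_bounds hP hq hg hh d t
  obtain ⟨h1, h2⟩ := clog_facts hP hq d
  obtain ⟨h1', h2'⟩ := clog_facts hP hq d'
  have hmono : Nat.clog P (q ^ d) ≤ Nat.clog P (q ^ d') :=
    Nat.clog_mono_right _ (Nat.pow_le_pow_right (by omega) hd.le)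
  set c := Nat.clog P (q ^ d)
  set c' := Nat.clog P (q ^ d')
  obtain ⟨i, hi⟩ := Nat.exists_eq_add_of_le hmono
  obtain ⟨j, hj⟩ := Nat.exists_eq_add_of_le hd.le
  have hj0 : 1 ≤ j := by omega
  have hq0 : (0 : ℝ) < (q : ℝ) := by positivity
  have hP0 : (0 : ℝ) < (P : ℝ) := by positivity
  set z := ph P q g h d (c + t) with hz
  set z' := ph P q g h d' (c' + t) with hz'
  have rel : z' * (q : ℝ) ^ j = z * (P : ℝ) ^ i := by
    rw [hz, hz']; unfold ph; rw [hi, hj]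
    have e1 : (q : ℝ) ^ (d + j) = q ^ d * q ^ j := pow_add _ _ _
    rw [e1]
    field_simp
    ring
  rw [← heq] at n2
  set a := round z with ha
  have ha1 : (1 : ℝ) ≤ a := by
    have : (1 : ℤ) ≤ a := by
      rw [ha, round_eq, Int.le_floor]; push_cast; linarith
    exact_mod_cast this
  -- integers differ
  have hne : (P : ℤ) ^ i ≠ (q : ℤ) ^ j := by
    intro h0
    have h0' : P ^ i = q ^ j := by exact_mod_cast h0
    have : Nat.Coprime (P ^ i) (q ^ j) := Nat.Coprime.pow _ _ hc
    rw [h0', Nat.coprime_self] at this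
    have : 1 < q ^ j := Nat.one_lt_pow (by omega) (by omega)
    omega
  have hdiff : (1 : ℝ) ≤ |(P : ℝ) ^ i - (q : ℝ) ^ j| := by
    have : (1 : ℤ) ≤ |(P : ℤ) ^ i - (q : ℤ) ^ j| := Int.one_le_abs (sub_ne_zero.2 hne)
    exact_mod_cast this
  -- P^i ≤ P q^j
  have hPi : P ^ i ≤ P * q ^ j := by
    have e1 : P ^ c * P ^ i ≤ P * (q ^ d * q ^ j) := by rw [← pow_add, ← pow_add, ← hi, ← hj]; exact h2'
    have e2 : q ^ d * P ^ i ≤ q ^ d * (P * q ^ j) := by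
      calc q ^ d * P ^ i ≤ P ^ c * P ^ i := Nat.mul_le_mul_right _ h1
        _ ≤ _ := e1
        _ = _ := by ring
    exact Nat.le_of_mul_le_mul_left e2 (by positivity)
  have hPi' : (P : ℝ) ^ i ≤ P * (q : ℝ) ^ j := by exact_mod_cast hPi
  have hR' : (1 + (P : ℝ)) * (q : ℝ) ^ J ≤ (P : ℝ) ^ R := by exact_mod_cast hR
  have hqj : (q : ℝ) ^ j ≤ (q : ℝ) ^ J :=
    pow_le_pow_right₀ (by exact_mod_cast (by omega : 1 ≤ q)) (by omega)
  have key : (a : ℝ) * ((P : ℝ) ^ i - (q : ℝ) ^ j) = (z' - a) * (q : ℝ) ^ j - (z - a) * (P : ℝ) ^ i := by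
    linear_combination -rel
  have k1 : 1 ≤ |z' - a| * (q : ℝ) ^ j + |z - a| * (P : ℝ) ^ i := by
    calc (1 : ℝ) ≤ a * |(P : ℝ) ^ i - (q : ℝ) ^ j| := one_le_mul_of_one_le_of_one_le ha1 hdiff
      _ = |(a : ℝ) * ((P : ℝ) ^ i - (q : ℝ) ^ j)| := by
          rw [abs_mul, abs_of_nonneg (by linarith : (0 : ℝ) ≤ a)]
      _ ≤ _ := by
          rw [key]
          refine (abs_sub _ _).trans ?_
          rw [abs_mul, abs_mul, abs_of_pos (by positivity : (0 : ℝ) < (q : ℝ) ^ j),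
            abs_of_pos (by positivity : (0 : ℝ) < (P : ℝ) ^ i)]
  have k2 : |z' - a| * (q : ℝ) ^ j ≤ |z' - a| * (q : ℝ) ^ J := by gcongr
  have k3 : |z - a| * (P : ℝ) ^ i ≤ |z - a| * (P * (q : ℝ) ^ J) := by
    gcongr; exact hPi'.trans (by gcongr)
  have hQ : (0 : ℝ) < (q : ℝ) ^ J := by positivity
  have k4 : |z' - a| * (q : ℝ) ^ J ≤ |z' - a| * (P : ℝ) ^ R := by
    gcongr; nlinarith
  have k5 : |z - a| * (P * (q : ℝ) ^ J) ≤ |z - a| * (P : ℝ) ^ R := by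
    gcongr; nlinarith
  linarith

open Classical in
lemma nofar_count {P q g h : ℕ} (hP : 2 ≤ P) (hq : 2 ≤ q) (hc : Nat.Coprime P q) (hg : 1 ≤ g)
    (hh : 1 ≤ h) (t : ℕ) (ε : ℝ) (hε : 0 < ε) : ∃ R : ℕ, ∃ K : ℝ, ∀ D : ℕ,
    (((Finset.range D).filter fun d =>
      ∀ i < R, ¬ far P q g h d (Nat.clog P (q ^ d) + t + i)).card : ℝ) ≤ ε * D + K := by
  set A := h * g * P ^ (t + 1) + 1 with hA
  obtain ⟨J, hJ⟩ := exists_nat_gt ((A + 1 : ℝ) / ε)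
  have hJ0 : (0 : ℝ) < J := lt_trans (by positivity) hJ
  have hJ0' : 0 < J := by exact_mod_cast hJ0
  obtain ⟨R, hR⟩ : ∃ R : ℕ, (1 + P) * q ^ J < P ^ R := pow_unbounded_of_one_lt _ (by omega)
  have hR1 : 1 ≤ R := by
    rcases Nat.eq_zero_or_pos R with rfl | h0
    · have : 0 < q ^ J := by positivity
      simp at hR; nlinarith
    · exact h0
  refine ⟨R, A + 1, fun D => ?_⟩
  set z : ℕ → ℝ := fun d => ph P q g h d (Nat.clog P (q ^ d) + t) with hz
  set S := (Finset.range D).filter fun d =>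
      ∀ i < R, ¬ far P q g h d (Nat.clog P (q ^ d) + t + i) with hS
  have hnear : ∀ d ∈ S, |z d - round (z d)| * (P : ℝ) ^ R < 1 / 2 := by
    intro d hd
    rw [hS, Finset.mem_filter] at hd
    refine round_run hP (z d) R hR1 fun i hi => ?_
    have := hd.2 i hi
    unfold far at this
    rw [not_le] at this
    have e : ph P q g h d (Nat.clog P (q ^ d) + t + i) = z d * (P : ℝ) ^ i := by
      rw [hz]; unfold ph; rw [pow_add]; ring
    rwa [e] at this
  have hcard : S.card ≤ (Finset.range (A + 1) ×ˢ Finset.range (D / J + 1)).card := by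
    refine Finset.card_le_card_of_injOn (fun d => ((round (z d)).toNat, d / J)) ?_ ?_
    · intro d hd
      have hd' : d < D := by
        have := Finset.mem_filter.1 (Finset.mem_coe.1 hd)
        exact Finset.mem_range.1 this.1
      obtain ⟨b1, b2⟩ := ph_bounds hP hq hg hh d t
      simp only [Finset.coe_product, Set.mem_prod, Finset.mem_coe, Finset.mem_range]
      constructor
      · have : round (z d) ≤ (A : ℤ) := by
          rw [round_eq]
          have : (⌊z d + 1 / 2⌋ : ℤ) < (A : ℤ) + 1 := by
            rw [Int.floor_lt]; push_cast [hA]; push_cast at b2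
            have : z d ≤ h * g * (P : ℝ) ^ (t + 1) := b2
            linarith
          omega
        omega
      · exact Nat.lt_succ_of_le (Nat.div_le_div_right hd'.le)
    · have main : ∀ d ∈ S, ∀ d' ∈ S, d < d' → (round (z d)).toNat = (round (z d')).toNat →
          d / J = d' / J → False := by
        intro d hd d' hd' hlt h1 h2
        have p1 : ∀ d, 1 ≤ round (z d) := fun d => by
          have := (ph_bounds hP hq hg hh d t).1
          rw [round_eq, Int.le_floor]; push_cast
          have : 1 ≤ z d := this
          linarith
        refine sep hP hq hc hg hh t R J d d' hR.le hlt ?_ (hnear d hd) (hnear d' hd') ?_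
        · have e1 := Nat.div_add_mod d J
          have e2 := Nat.div_add_mod d' J
          have e3 := Nat.mod_lt d' hJ0'
          rw [← h2] at e2
          omega
        · have := p1 d
          have := p1 d'
          change round (z d) = round (z d')
          omega
      intro d hd d' hd' heq
      simp only [Prod.mk.injEq] at heq
      rcases lt_trichotomy d d' with h0 | h0 | h0
      · exact (main d hd d' hd' h0 heq.1 heq.2).elim
      · exact h0
      · exact (main d' hd' d hd h0 heq.1.symm heq.2.symm).elim
  rw [Finset.card_product, Finset.card_range, Finset.card_range] at hcard
  have h1 : (S.card : ℝ) ≤ (A + 1) * ((D / J : ℕ) + 1) := by exact_mod_cast hcard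
  have h2 : ((D / J : ℕ) : ℝ) ≤ D / J := Nat.cast_div_le
  have h3 : (A + 1 : ℝ) * (D / J) ≤ ε * D := by
    rw [div_lt_iff₀ hε] at hJ
    rw [mul_div_assoc', div_le_iff₀ hJ0]
    have : (0 : ℝ) ≤ D := Nat.cast_nonneg _
    nlinarith
  have h4 : (A + 1 : ℝ) * (D / J : ℕ) ≤ (A + 1) * (D / J) := by gcongr
  linarith

open Classical in
/-- number of far phases in the window of length `T` -/
noncomputable def cnt (P q g h d T : ℕ) : ℕ :=
  ((Finset.range T).filter fun i => far P q g h d (Nat.clog P (q ^ d) + i)).card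

lemma cnt_mono (P q g h d : ℕ) {T T' : ℕ} (hT : T ≤ T') : cnt P q g h d T ≤ cnt P q g h d T' := by
  classical
  unfold cnt
  exact Finset.card_le_card (Finset.filter_subset_filter _ (Finset.range_mono hT))

lemma cnt_succ (P q g h d T R : ℕ) (hex : ∃ i < R, far P q g h d (Nat.clog P (q ^ d) + T + i)) :
    cnt P q g h d T + 1 ≤ cnt P q g h d (T + R) := by
  classical
  obtain ⟨i, hi, hf⟩ := hex
  unfold cnt
  have hn : T + i ∉ (Finset.range T).filter fun i => far P q g h d (Nat.clog P (q ^ d) + i) := by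
    simp
  rw [← Finset.card_insert_of_notMem hn]
  refine Finset.card_le_card ?_
  intro x hx
  rw [Finset.mem_insert] at hx
  rcases hx with rfl | hx
  · rw [Finset.mem_filter, Finset.mem_range]
    exact ⟨by omega, by rwa [← add_assoc]⟩
  · rw [Finset.mem_filter, Finset.mem_range] at *
    exact ⟨by omega, hx.2⟩

open Classical in
lemma cnt_count {P q g h : ℕ} (hP : 2 ≤ P) (hq : 2 ≤ q) (hc : Nat.Coprime P q) (hg : 1 ≤ g)
    (hh : 1 ≤ h) (m : ℕ) : ∀ (ε : ℝ), 0 < ε → ∃ T : ℕ, ∃ K : ℝ, ∀ D : ℕ,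
    (((Finset.range D).filter fun d => cnt P q g h d T < m).card : ℝ) ≤ ε * D + K := by
  induction m with
  | zero => intro ε hε; exact ⟨0, 0, fun D => by simp; positivity⟩
  | succ m ih =>
    intro ε hε
    obtain ⟨T, K, hK⟩ := ih (ε / 2) (by positivity)
    obtain ⟨R, K', hK'⟩ := nofar_count hP hq hc hg hh T (ε / 2) (by positivity)
    refine ⟨T + R, K + K', fun D => ?_⟩
    have hsub : ((Finset.range D).filter fun d => cnt P q g h d (T + R) < m + 1) ⊆
        ((Finset.range D).filter fun d => cnt P q g h d T < m) ∪
        ((Finset.range D).filter fun d =>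
          ∀ i < R, ¬ far P q g h d (Nat.clog P (q ^ d) + T + i)) := by
      intro d hd
      rw [Finset.mem_filter] at hd
      rw [Finset.mem_union, Finset.mem_filter, Finset.mem_filter]
      by_cases h0 : ∃ i < R, far P q g h d (Nat.clog P (q ^ d) + T + i)
      · left
        have := cnt_succ P q g h d T R h0
        exact ⟨hd.1, by omega⟩
      · right
        push Not at h0
        exact ⟨hd.1, h0⟩
    have h1 := (Finset.card_le_card hsub).trans (Finset.card_union_le _ _)
    have h1' : (((Finset.range D).filter fun d => cnt P q g h d (T + R) < m + 1).card : ℝ) ≤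
      (((Finset.range D).filter fun d => cnt P q g h d T < m).card : ℝ) +
        (((Finset.range D).filter fun d =>
          ∀ i < R, ¬ far P q g h d (Nat.clog P (q ^ d) + T + i)).card : ℝ) := by exact_mod_cast h1
    linarith [hK D, hK' D]

def goodD (P q g m H T d : ℕ) : Prop := ∀ h, 1 ≤ h → h ≤ H → m ≤ cnt P q g h d T

open Classical in
lemma bad_count {P q g : ℕ} (hP : 2 ≤ P) (hq : 2 ≤ q) (hc : Nat.Coprime P q) (hg : 1 ≤ g)
    (m H : ℕ) : ∀ (ε : ℝ), 0 < ε → ∃ T : ℕ, ∃ K : ℝ, ∀ D : ℕ,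
    (((Finset.range D).filter fun d =>
      ¬ goodD P q g m H T d).card : ℝ) ≤ ε * D + K := by
  induction H with
  | zero =>
    intro ε hε
    refine ⟨0, 0, fun D => ?_⟩
    rw [Finset.filter_false_of_mem]
    · simp; positivity
    · intro d _ h0
      exact h0 fun h h1 h2 => by omega
  | succ H ih =>
    intro ε hε
    obtain ⟨T, K, hK⟩ := ih (ε / 2) (by positivity)
    obtain ⟨T', K', hK'⟩ := cnt_count hP hq hc hg (h := H + 1) (by omega) m (ε / 2) (by positivity)
    refine ⟨max T T', K + K', fun D => ?_⟩
    have hsub : ((Finset.range D).filter fun d =>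
          ¬ goodD P q g m (H + 1) (max T T') d) ⊆
        ((Finset.range D).filter fun d => ¬ goodD P q g m H T d) ∪
        ((Finset.range D).filter fun d => cnt P q g (H + 1) d T' < m) := by
      intro d hd
      rw [Finset.mem_filter] at hd
      rw [Finset.mem_union, Finset.mem_filter, Finset.mem_filter]
      by_contra hcon
      push Not at hcon
      unfold goodD at hcon
      refine hd.2 fun h h1 h2 => ?_
      rcases Nat.lt_or_ge H h with h3 | h3
      · obtain rfl : h = H + 1 := by omega
        exact (hcon.2 hd.1).trans (cnt_mono _ _ _ _ _ (le_max_right _ _))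
      · exact (hcon.1 hd.1 h h1 h3).trans (cnt_mono _ _ _ _ _ (le_max_left _ _))
    have h1 := (Finset.card_le_card hsub).trans (Finset.card_union_le _ _)
    have h1' : (((Finset.range D).filter fun d =>
          ¬ goodD P q g m (H + 1) (max T T') d).card : ℝ) ≤
        (((Finset.range D).filter fun d =>
          ¬ goodD P q g m H T d).card : ℝ) +
        (((Finset.range D).filter fun d => cnt P q g (H + 1) d T' < m).card : ℝ) := by
      exact_mod_cast h1
    linarith [hK D, hK' D]

open Real in
lemma norm_one_add_exp_le_two (φ : ℝ) : ‖1 + Complex.exp ((φ : ℂ) * Complex.I)‖ ≤ 2 := by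
  refine (norm_add_le _ _).trans ?_
  rw [Complex.norm_exp_ofReal_mul_I]; norm_num

open Real in
lemma norm_one_add_exp_far {P : ℕ} (hP : 2 ≤ P) : ∃ ρ : ℝ, 0 ≤ ρ ∧ ρ < 1 ∧ ∀ u : ℝ,
    1 / (2 * (P : ℝ)) ≤ |u - round u| →
    ‖1 + Complex.exp (((2 * π * u : ℝ) : ℂ) * Complex.I)‖ ≤ 2 * ρ := by
  have hP' : (2 : ℝ) ≤ P := by exact_mod_cast hP
  have hpos : 0 < π / P := by positivity
  have hlepi : π / P ≤ π := div_le_self Real.pi_pos.le (by linarith)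
  have hcos : Real.cos (π / P) < 1 := by
    have := Real.cos_lt_cos_of_nonneg_of_le_pi (le_refl 0) hlepi hpos
    rwa [Real.cos_zero] at this
  have hcos' := Real.neg_one_le_cos (π / P)
  refine ⟨Real.sqrt ((1 + Real.cos (π / P)) / 2), Real.sqrt_nonneg _, ?_, fun u hu => ?_⟩
  · rw [Real.sqrt_lt' one_pos]; linarith
  · have hn : ‖1 + Complex.exp (((2 * π * u : ℝ) : ℂ) * Complex.I)‖ ^ 2 =
        2 + 2 * Real.cos (2 * π * u) := by
      rw [← Complex.normSq_eq_norm_sq, Complex.normSq_apply, Complex.add_re, Complex.add_im,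
        Complex.exp_ofReal_mul_I_re, Complex.exp_ofReal_mul_I_im, Complex.one_re, Complex.one_im]
      nlinarith [Real.sin_sq_add_cos_sq (2 * π * u)]
    have hc : Real.cos (2 * π * u) ≤ Real.cos (π / P) := by
      have e : Real.cos (2 * π * u) = Real.cos (2 * π * |u - round u|) := by
        have h1 : Real.cos (2 * π * |u - round u|) = Real.cos (2 * π * (u - round u)) := by
          rw [← Real.cos_abs (2 * π * (u - round u)), abs_mul, abs_of_pos (by positivity : 0 < 2 * π)]
        rw [h1, mul_sub, ← Real.cos_sub_int_mul_two_pi (2 * π * u) (round u)]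
        congr 1; ring
      rw [e]
      have h2 := abs_sub_round u
      refine Real.cos_le_cos_of_nonneg_of_le_pi hpos.le ?_ ?_
      · nlinarith [Real.pi_pos]
      · calc π / P = 2 * π * (1 / (2 * (P : ℝ))) := by field_simp
          _ ≤ _ := by gcongr
    rw [← abs_of_nonneg (norm_nonneg (1 + Complex.exp (((2 * π * u : ℝ) : ℂ) * Complex.I)))]
    apply abs_le_of_sq_le_sq _ (by positivity)
    rw [hn, mul_pow, Real.sq_sqrt (by linarith)]
    linarith

open Real in
lemma exp_sum_prod (W : Finset ℕ) (h : ℕ) (x : ℕ → ℝ) (y : ℝ) :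
    ‖∑ B ∈ W.powerset, Complex.exp (((2 * π * h * (y + ∑ c ∈ B, x c) : ℝ) : ℂ) * Complex.I)‖ =
    ∏ c ∈ W, ‖1 + Complex.exp (((2 * π * (h * x c) : ℝ) : ℂ) * Complex.I)‖ := by
  rw [← norm_prod, Finset.prod_one_add]
  have : ∑ B ∈ W.powerset, Complex.exp (((2 * π * h * (y + ∑ c ∈ B, x c) : ℝ) : ℂ) * Complex.I) =
      Complex.exp (((2 * π * h * y : ℝ) : ℂ) * Complex.I) * ∑ B ∈ W.powerset,
        ∏ c ∈ B, Complex.exp (((2 * π * (h * x c) : ℝ) : ℂ) * Complex.I) := by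
    rw [Finset.mul_sum]
    refine Finset.sum_congr rfl fun B _ => ?_
    rw [← Complex.exp_sum, ← Complex.exp_add]
    congr 1
    push_cast
    rw [← Finset.sum_mul, ← add_mul, ← Finset.mul_sum, ← Finset.mul_sum]
    ring
  rw [this, norm_mul, Complex.norm_exp_ofReal_mul_I, one_mul]

/-- the window of `d` -/
def win (P q T d : ℕ) : Finset ℕ := Finset.Ico (Nat.clog P (q ^ d)) (Nat.clog P (q ^ d) + T)

lemma win_avg {P g : ℕ} (q : ℕ) (hP : 2 ≤ P) (ε : ℝ) (hε : 0 < ε) : ∃ H m : ℕ, ∀ T d : ℕ,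
    goodD P q g m H T d → ∀ y : ℝ,
    |∑ B ∈ (win P q T d).powerset,
      (Int.fract (y + ∑ c ∈ B, (g : ℝ) * (P : ℝ) ^ c / (q : ℝ) ^ d) - 1 / 2)| ≤
      ε * (win P q T d).powerset.card := by
  classical
  obtain ⟨H, κ, hκ, hH⟩ := saw_avg ε hε
  obtain ⟨ρ, hρ0, hρ1, hρ⟩ := norm_one_add_exp_far hP
  obtain ⟨m, hm⟩ := exists_pow_lt_of_lt_one hκ hρ1
  refine ⟨H, m, fun T d hgood y => ?_⟩
  refine hH _ _ fun h h1 h2 => ?_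
  rw [exp_sum_prod]
  have hcnt := hgood h h1 h2
  unfold win
  rw [Finset.prod_Ico_eq_prod_range, Finset.card_powerset, Nat.card_Ico, Nat.add_sub_cancel_left]
  calc ∏ i ∈ Finset.range T, ‖1 + Complex.exp (((2 * Real.pi * (h * ((g : ℝ) *
          (P : ℝ) ^ (Nat.clog P (q ^ d) + i) / (q : ℝ) ^ d)) : ℝ) : ℂ) * Complex.I)‖
      ≤ ∏ i ∈ Finset.range T, (2 * if far P q g h d (Nat.clog P (q ^ d) + i) then ρ else 1) := by
        refine Finset.prod_le_prod (fun _ _ => norm_nonneg _) fun i _ => ?_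
        split_ifs with hf
        · exact hρ _ hf
        · rw [mul_one]; exact norm_one_add_exp_le_two _
    _ = 2 ^ T * ρ ^ cnt P q g h d T := by
        rw [Finset.prod_mul_distrib, Finset.prod_const, Finset.card_range, Finset.prod_ite,
          Finset.prod_const, Finset.prod_const_one, mul_one]
        rfl
    _ ≤ 2 ^ T * κ := by
        gcongr
        exact (pow_le_pow_of_le_one hρ0 hρ1.le hcnt).trans hm.le
    _ = κ * ((2 ^ T : ℕ) : ℝ) := by push_cast; ring

lemma powerset_split {U W : Finset ℕ} (hW : W ⊆ U) (G : Finset ℕ → ℝ) :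
    ∑ B ∈ U.powerset, G B = ∑ B0 ∈ (U \ W).powerset, ∑ B1 ∈ W.powerset, G (B0 ∪ B1) := by
  rw [← Finset.sum_product']
  refine Finset.sum_nbij' (fun B => (B \ W, B ∩ W)) (fun x => x.1 ∪ x.2) ?_ ?_ ?_ ?_ ?_
  · intro B hB
    rw [Finset.mem_powerset] at hB
    rw [Finset.mem_product, Finset.mem_powerset, Finset.mem_powerset]
    exact ⟨Finset.sdiff_subset_sdiff hB (Finset.Subset.refl _), Finset.inter_subset_right⟩
  · rintro ⟨B0, B1⟩ hB
    rw [Finset.mem_product, Finset.mem_powerset, Finset.mem_powerset] at hB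
    rw [Finset.mem_powerset]
    exact Finset.union_subset (hB.1.trans Finset.sdiff_subset) (hB.2.trans hW)
  · intro B _
    exact Finset.sdiff_union_inter B W
  · rintro ⟨B0, B1⟩ hB
    rw [Finset.mem_product, Finset.mem_powerset, Finset.mem_powerset] at hB
    have h1 : ∀ c ∈ B0, c ∉ W := fun c hc => (Finset.mem_sdiff.1 (hB.1 hc)).2
    have h2 : ∀ c ∈ B1, c ∈ W := fun c hc => hB.2 hc
    simp only [Prod.mk.injEq]
    constructor <;> ext c <;> simp only [Finset.mem_sdiff, Finset.mem_union, Finset.mem_inter] <;>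
      have := h1 c <;> have := h2 c <;> tauto
  · intro B _
    simp only
    rw [Finset.sdiff_union_inter]

lemma weighted {U W : Finset ℕ} (hW : W ⊆ U) (x : ℕ → ℝ) (ε M : ℝ) (hM : 0 ≤ M)
    (hx : ∀ y : ℝ, |∑ B ∈ W.powerset, (Int.fract (y + ∑ c ∈ B, x c) - 1 / 2)| ≤
      ε * W.powerset.card) (φ η : Finset ℕ → ℝ) (hφ : ∀ B, |φ B| ≤ M) :
    |∑ B ∈ U.powerset, φ (B \ W) * (Int.fract (η (B \ W) + ∑ c ∈ B ∩ W, x c) - 1 / 2)| ≤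
      M * ε * U.powerset.card := by
  rw [powerset_split hW]
  have h1 : ∀ B0 ∈ (U \ W).powerset, |∑ B1 ∈ W.powerset, φ ((B0 ∪ B1) \ W) *
      (Int.fract (η ((B0 ∪ B1) \ W) + ∑ c ∈ (B0 ∪ B1) ∩ W, x c) - 1 / 2)| ≤
      M * (ε * W.powerset.card) := by
    intro B0 hB0
    rw [Finset.mem_powerset] at hB0
    have h1 : ∀ c ∈ B0, c ∉ W := fun c hc => (Finset.mem_sdiff.1 (hB0 hc)).2
    have h2 : ∑ B1 ∈ W.powerset, φ ((B0 ∪ B1) \ W) *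
      (Int.fract (η ((B0 ∪ B1) \ W) + ∑ c ∈ (B0 ∪ B1) ∩ W, x c) - 1 / 2) =
      φ B0 * ∑ B1 ∈ W.powerset, (Int.fract (η B0 + ∑ c ∈ B1, x c) - 1 / 2) := by
      rw [Finset.mul_sum]
      refine Finset.sum_congr rfl fun B1 hB1 => ?_
      rw [Finset.mem_powerset] at hB1
      have e1 : (B0 ∪ B1) \ W = B0 := by
        ext c; simp only [Finset.mem_sdiff, Finset.mem_union]
        have := h1 c; have := @hB1 c; tauto
      have e2 : (B0 ∪ B1) ∩ W = B1 := by
        ext c; simp only [Finset.mem_inter, Finset.mem_union]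
        have := h1 c; have := @hB1 c; tauto
      rw [e1, e2]
    rw [h2, abs_mul]
    exact mul_le_mul (hφ B0) (hx _) (abs_nonneg _) hM
  refine (Finset.abs_sum_le_sum_abs _ _).trans ((Finset.sum_le_sum h1).trans (le_of_eq ?_))
  rw [Finset.sum_const, nsmul_eq_mul]
  have : U.powerset.card = (U \ W).powerset.card * W.powerset.card := by
    rw [Finset.card_powerset, Finset.card_powerset, Finset.card_powerset, ← pow_add,
      Finset.card_sdiff_add_card_eq_card hW]
  rw [this]; push_cast; ring

lemma saw_abs (x : ℝ) : |Int.fract x - 1 / 2| ≤ 1 / 2 := by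
  rw [abs_le]; constructor <;> linarith [Int.fract_nonneg x, Int.fract_lt_one x]

lemma pair_bound {U W W' : Finset ℕ} (hW : W ⊆ U) (hW' : W' ⊆ U) (hdis : Disjoint W W')
    (x x' : ℕ → ℝ) (Y Y' ε τ : ℝ) (hxpos : ∀ c, 0 ≤ x c) (hτ : ∑ c ∈ W', x c ≤ τ)
    (hx : ∀ y : ℝ, |∑ B ∈ W.powerset, (Int.fract (y + ∑ c ∈ B, x c) - 1 / 2)| ≤
      ε * W.powerset.card)
    (hx' : ∀ y : ℝ, |∑ B ∈ W'.powerset, (Int.fract (y + ∑ c ∈ B, x' c) - 1 / 2)| ≤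
      ε * W'.powerset.card) :
    |∑ B ∈ U.powerset, (Int.fract (Y + ∑ c ∈ B, x c) - 1 / 2) *
      (Int.fract (Y' + ∑ c ∈ B, x' c) - 1 / 2)| ≤ (2 * ε + τ) * U.powerset.card := by
  have hsplit : ∀ (z : ℕ → ℝ) (V B : Finset ℕ), ∑ c ∈ B, z c = ∑ c ∈ B \ V, z c + ∑ c ∈ B ∩ V, z c := by
    intro z V B
    rw [add_comm, Finset.sum_inter_add_sum_sdiff]
  set ψ : Finset ℕ → ℝ := fun B => Int.fract (Y + ∑ c ∈ B, x c) - 1 / 2 with hψ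
  set ψ' : Finset ℕ → ℝ := fun B => Int.fract (Y' + ∑ c ∈ B, x' c) - 1 / 2 with hψ'
  have A1 : |∑ B ∈ U.powerset, ψ (B \ W') * ψ' B| ≤ 1 / 2 * ε * U.powerset.card := by
    have := weighted hW' x' ε (1 / 2) (by norm_num) hx' ψ (fun B => Y' + ∑ c ∈ B, x' c)
      (fun B => saw_abs _)
    convert this using 5 with B hB
    rw [hsplit x' W' B, add_assoc]
  have A2 : |∑ B ∈ U.powerset, ψ B| ≤ ε * U.powerset.card := by
    have := weighted hW x ε 1 (by norm_num) hx (fun _ => 1) (fun B => Y + ∑ c ∈ B, x c)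
      (fun B => by simp)
    rw [one_mul] at this
    convert this using 4 with B hB
    rw [hψ]; simp only
    rw [hsplit x W B]; ring_nf
  have A3 : |∑ B ∈ U.powerset, ψ (B \ W')| ≤ ε * U.powerset.card := by
    have := weighted hW x ε 1 (by norm_num) hx (fun _ => 1) (fun B => Y + ∑ c ∈ B \ W', x c)
      (fun B => by simp)
    rw [one_mul] at this
    convert this using 4 with B hB
    rw [hψ]; simp only
    rw [hsplit x W (B \ W')]
    have e1 : (B \ W') \ W = (B \ W) \ W' := by
      ext c; simp only [Finset.mem_sdiff]; tauto
    have e2 : (B \ W') ∩ W = B ∩ W := by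
      ext c; simp only [Finset.mem_sdiff, Finset.mem_inter]
      have : c ∈ W → c ∉ W' := fun h h' => Finset.disjoint_left.1 hdis h h'
      tauto
    rw [e1, e2]; ring_nf
  -- difference
  have hdiff : ∀ B, |ψ B - ψ (B \ W')| ≤ 2 * τ - (ψ B - ψ (B \ W')) := by
    intro B
    have hs := hsplit x W' B
    have ht0 : 0 ≤ ∑ c ∈ B ∩ W', x c := Finset.sum_nonneg fun c _ => hxpos c
    have ht1 : ∑ c ∈ B ∩ W', x c ≤ τ :=
      (Finset.sum_le_sum_of_subset_of_nonneg Finset.inter_subset_right fun c _ _ => hxpos c).trans hτ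
    set a := Y + ∑ c ∈ B \ W', x c with ha
    have hb : Y + ∑ c ∈ B, x c = a + ∑ c ∈ B ∩ W', x c := by rw [hs, ha]; ring
    have hle : (⌊a⌋ : ℝ) ≤ ⌊a + ∑ c ∈ B ∩ W', x c⌋ := by
      exact_mod_cast Int.floor_mono (by linarith)
    have e : ψ B - ψ (B \ W') = ∑ c ∈ B ∩ W', x c - (⌊a + ∑ c ∈ B ∩ W', x c⌋ - ⌊a⌋) := by
      rw [hψ]; simp only
      rw [hb, ← ha, Int.fract, Int.fract]; ring
    rw [e, abs_le]
    constructor <;> linarith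
  have A4 : ∑ B ∈ U.powerset, |ψ B - ψ (B \ W')| ≤ (2 * τ + 2 * ε) * U.powerset.card := by
    refine (Finset.sum_le_sum fun B _ => hdiff B).trans ?_
    rw [Finset.sum_sub_distrib, Finset.sum_sub_distrib, Finset.sum_const, nsmul_eq_mul]
    rw [abs_le] at A2 A3
    linarith [A2.1, A3.2]
  have A5 : |∑ B ∈ U.powerset, (ψ B - ψ (B \ W')) * ψ' B| ≤ (τ + ε) * U.powerset.card := by
    refine (Finset.abs_sum_le_sum_abs _ _).trans ?_
    have : ∀ B ∈ U.powerset, |(ψ B - ψ (B \ W')) * ψ' B| ≤ |ψ B - ψ (B \ W')| * (1 / 2) := by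
      intro B _
      rw [abs_mul]
      exact mul_le_mul_of_nonneg_left (saw_abs _) (abs_nonneg _)
    refine (Finset.sum_le_sum this).trans ?_
    rw [← Finset.sum_mul]
    linarith
  have e : ∑ B ∈ U.powerset, ψ B * ψ' B = ∑ B ∈ U.powerset, ψ (B \ W') * ψ' B +
      ∑ B ∈ U.powerset, (ψ B - ψ (B \ W')) * ψ' B := by
    rw [← Finset.sum_add_distrib]
    refine Finset.sum_congr rfl fun B _ => by ring
  change |∑ B ∈ U.powerset, ψ B * ψ' B| ≤ _
  rw [e]
  refine (abs_add_le _ _).trans ?_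
  have hε : 0 ≤ ε * U.powerset.card := (abs_nonneg _).trans A2
  linarith

lemma second_moment {S : Finset (Finset ℕ)} (hS : S.Nonempty) (D L : ℕ) (G : Finset ℕ)
    (hG : G ⊆ Finset.range D) (δ : ℝ) (hδ : 0 < δ) (ψ : ℕ → Finset ℕ → ℝ)
    (hψ : ∀ d B, |ψ d B| ≤ 1 / 2)
    (hpair : ∀ d ∈ G, ∀ d' ∈ G, d' + L ≤ d → |∑ B ∈ S, ψ d B * ψ d' B| ≤ δ ^ 2 * S.card) :
    ∃ B ∈ S, |∑ d ∈ G, ψ d B| ≤ δ * D + L / δ := by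
  classical
  have hcard : (G.card : ℝ) ≤ D := by
    have := Finset.card_le_card hG
    rw [Finset.card_range] at this
    exact_mod_cast this
  have hb : ∀ d ∈ G, ∀ d' ∈ G, ∑ B ∈ S, ψ d B * ψ d' B ≤
      (δ ^ 2 + if d < d' + L ∧ d' < d + L then 1 else 0) * S.card := by
    intro d hd d' hd'
    split_ifs with h
    · have : ∑ B ∈ S, ψ d B * ψ d' B ≤ ∑ B ∈ S, (1 : ℝ) := by
        refine Finset.sum_le_sum fun B _ => ?_
        refine (le_abs_self _).trans ?_
        rw [abs_mul]
        have := mul_le_mul (hψ d B) (hψ d' B) (abs_nonneg _) (by norm_num)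
        linarith
      rw [Finset.sum_const, nsmul_eq_mul, mul_one] at this
      have : 0 ≤ δ ^ 2 * (S.card : ℝ) := by positivity
      linarith
    · rw [add_zero]
      rcases le_total d d' with h1 | h1
      · have := hpair d' hd' d hd (by omega)
        refine (le_abs_self _).trans ?_
        simpa only [mul_comm] using this
      · exact (le_abs_self _).trans (hpair d hd d' hd' (by omega))
  have hrow : ∀ d ∈ G, ∑ d' ∈ G, (δ ^ 2 + if d < d' + L ∧ d' < d + L then (1 : ℝ) else 0) ≤
      δ ^ 2 * D + 2 * L := by
    intro d _
    rw [Finset.sum_add_distrib, Finset.sum_const, nsmul_eq_mul, Finset.sum_boole]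
    have h1 : (G.filter fun d' => d < d' + L ∧ d' < d + L) ⊆ Finset.Ico (d + 1 - L) (d + L) := by
      intro c hc
      rw [Finset.mem_filter] at hc
      rw [Finset.mem_Ico]; omega
    have h2 := Finset.card_le_card h1
    rw [Nat.card_Ico] at h2
    have h3 : (G.filter fun d' => d < d' + L ∧ d' < d + L).card ≤ 2 * L := by omega
    have h4 : ((G.filter fun d' => d < d' + L ∧ d' < d + L).card : ℝ) ≤ 2 * L := by exact_mod_cast h3
    have h5 : (G.card : ℝ) * δ ^ 2 ≤ D * δ ^ 2 := by gcongr
    linarith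
  have htot : ∑ B ∈ S, (∑ d ∈ G, ψ d B) ^ 2 ≤ ∑ B ∈ S, ((D : ℝ) * (δ ^ 2 * D + 2 * L)) := by
    calc ∑ B ∈ S, (∑ d ∈ G, ψ d B) ^ 2 = ∑ d ∈ G, ∑ d' ∈ G, ∑ B ∈ S, ψ d B * ψ d' B := by
          simp_rw [sq, Finset.sum_mul_sum]
          rw [Finset.sum_comm]
          refine Finset.sum_congr rfl fun d _ => ?_
          rw [Finset.sum_comm]
      _ ≤ ∑ d ∈ G, ∑ d' ∈ G, (δ ^ 2 + if d < d' + L ∧ d' < d + L then 1 else 0) * S.card :=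
          Finset.sum_le_sum fun d hd => Finset.sum_le_sum fun d' hd' => hb d hd d' hd'
      _ ≤ ∑ d ∈ G, (δ ^ 2 * D + 2 * L) * S.card := by
          refine Finset.sum_le_sum fun d hd => ?_
          rw [← Finset.sum_mul]
          exact mul_le_mul_of_nonneg_right (hrow d hd) (by positivity)
      _ ≤ _ := by
          rw [Finset.sum_const, Finset.sum_const, nsmul_eq_mul, nsmul_eq_mul]
          have : (G.card : ℝ) * ((δ ^ 2 * D + 2 * L) * S.card) ≤
            D * ((δ ^ 2 * D + 2 * L) * S.card) := by gcongr
          linarith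
  obtain ⟨B, hB, hle⟩ := Finset.exists_le_of_sum_le hS htot
  refine ⟨B, hB, ?_⟩
  refine abs_le_of_sq_le_sq ?_ (by positivity)
  refine hle.trans ?_
  have e : (δ * D + L / δ) ^ 2 = D * (δ ^ 2 * D + 2 * L) + (L / δ) ^ 2 := by
    field_simp; ring
  rw [e]
  have := sq_nonneg ((L : ℝ) / δ)
  linarith

lemma clog_pair {P q : ℕ} (hP : 2 ≤ P) (hq : 2 ≤ q) {T L d d' : ℕ} (hL : P ^ (T + 1) ≤ q ^ L)
    (hd : d' + L ≤ d) : Nat.clog P (q ^ d') + T ≤ Nat.clog P (q ^ d) := by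
  have h1 := (clog_facts hP hq d').2
  have h2 := (clog_facts hP hq d).1
  have : P ^ (Nat.clog P (q ^ d') + T) ≤ P ^ (Nat.clog P (q ^ d)) := by
    calc P ^ (Nat.clog P (q ^ d') + T) = P ^ (Nat.clog P (q ^ d')) * P ^ T := pow_add _ _ _
      _ ≤ P * q ^ d' * P ^ T := by gcongr
      _ = P ^ (T + 1) * q ^ d' := by ring
      _ ≤ q ^ L * q ^ d' := by gcongr
      _ = q ^ (d' + L) := by ring
      _ ≤ q ^ d := Nat.pow_le_pow_right (by omega) hd
      _ ≤ _ := h2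
  exact (Nat.pow_le_pow_iff_right (by omega)).1 this

lemma geom_win {P : ℕ} (hP : 2 ≤ P) (a T : ℕ) :
    ∑ c ∈ Finset.Ico a (a + T), (P : ℝ) ^ c ≤ (P : ℝ) ^ (a + T) := by
  have hP' : (2 : ℝ) ≤ P := by exact_mod_cast hP
  induction T with
  | zero => simp
  | succ T ih =>
    rw [← add_assoc, Finset.sum_Ico_succ_top (by omega), pow_succ]
    have : (0 : ℝ) ≤ (P : ℝ) ^ (a + T) := by positivity
    nlinarith

lemma win_small {P q g : ℕ} (hP : 2 ≤ P) (hq : 2 ≤ q) {T L d d' : ℕ} {τ : ℝ}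
    (hL : (g : ℝ) * (P : ℝ) ^ (T + 1) ≤ τ * (q : ℝ) ^ L) (hτ : 0 ≤ τ)
    (hd : d' + L ≤ d) : ∑ c ∈ win P q T d', (g : ℝ) * (P : ℝ) ^ c / (q : ℝ) ^ d ≤ τ := by
  have hq0 : (0 : ℝ) < (q : ℝ) := by exact_mod_cast (by omega : 0 < q)
  have hq1 : (1 : ℝ) ≤ (q : ℝ) := by exact_mod_cast (by omega : 1 ≤ q)
  rw [← Finset.sum_div, ← Finset.mul_sum, div_le_iff₀ (by positivity)]
  have h1 : (P : ℝ) ^ Nat.clog P (q ^ d') ≤ P * (q : ℝ) ^ d' := by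
    exact_mod_cast (clog_facts hP hq d').2
  calc (g : ℝ) * ∑ c ∈ win P q T d', (P : ℝ) ^ c
      ≤ g * (P : ℝ) ^ (Nat.clog P (q ^ d') + T) := by
        unfold win
        gcongr
        exact geom_win hP _ _
    _ = g * ((P : ℝ) ^ Nat.clog P (q ^ d') * (P : ℝ) ^ T) := by rw [pow_add]
    _ ≤ g * ((P * (q : ℝ) ^ d') * (P : ℝ) ^ T) := by gcongr
    _ = (g * (P : ℝ) ^ (T + 1)) * (q : ℝ) ^ d' := by ring
    _ ≤ τ * (q : ℝ) ^ L * (q : ℝ) ^ d' := by gcongr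
    _ = τ * (q : ℝ) ^ (d' + L) := by ring
    _ ≤ τ * (q : ℝ) ^ d := by gcongr

lemma nB_div (P f g C q d : ℕ) {B : Finset ℕ} (hB : B ⊆ Finset.range C) :
    (nB P f g C B : ℝ) / (q : ℝ) ^ d = (∑ c ∈ Finset.range C, (P : ℝ) ^ c * f) / (q : ℝ) ^ d +
      ∑ c ∈ B, (g : ℝ) * (P : ℝ) ^ c / (q : ℝ) ^ d := by
  rw [← Finset.sum_div, ← add_div]
  congr 1
  unfold nB
  push_cast
  simp_rw [mul_add]
  rw [Finset.sum_add_distrib]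
  congr 1
  simp_rw [mul_ite, mul_zero]
  rw [← Finset.sum_filter]
  have : (Finset.range C).filter (fun c => c ∈ B) = B := by
    ext c; rw [Finset.mem_filter]; exact ⟨fun h => h.2, fun h => ⟨hB h, h⟩⟩
  rw [this]
  exact Finset.sum_congr rfl fun c _ => mul_comm _ _

open Classical in
lemma good_sum {P q g : ℕ} (f : ℕ) (hP : 2 ≤ P) (hq : 2 ≤ q) (hc : Nat.Coprime P q) (hg : 1 ≤ g)
    (δ : ℝ) (hδ : 0 < δ) (hδ1 : δ ≤ 1) : ∃ T L : ℕ, ∃ K : ℝ, P ^ (T + 1) ≤ q ^ L ∧ ∀ D : ℕ,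
      ∃ B, |∑ d ∈ Finset.range D, (Int.fract ((nB P f g (Nat.clog P (q ^ D) + T) B : ℝ) /
        (q : ℝ) ^ d) - 1 / 2)| ≤ δ * D + K := by
  have hδ2 : 0 < δ ^ 2 / 16 := by positivity
  obtain ⟨H, m, hwin⟩ := win_avg (g := g) q hP (δ ^ 2 / 16) hδ2
  obtain ⟨T, K, hbad⟩ := bad_count hP hq hc hg m H (δ / 2) (by positivity)
  obtain ⟨L, hL⟩ := pow_unbounded_of_one_lt ((g : ℝ) * (P : ℝ) ^ (T + 1) / (δ ^ 2 / 8))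
    (by exact_mod_cast (by omega : 1 < q) : (1 : ℝ) < q)
  rw [div_lt_iff₀ (by positivity)] at hL
  have hL' : (g : ℝ) * (P : ℝ) ^ (T + 1) ≤ δ ^ 2 / 8 * (q : ℝ) ^ L := by linarith
  have hLn : P ^ (T + 1) ≤ q ^ L := by
    have h1 : (1 : ℝ) ≤ g := by exact_mod_cast hg
    have h2 : (P : ℝ) ^ (T + 1) ≤ (q : ℝ) ^ L := by
      have h3 : (P : ℝ) ^ (T + 1) ≤ g * (P : ℝ) ^ (T + 1) := le_mul_of_one_le_left (by positivity) h1
      have h4 : δ ^ 2 / 8 ≤ 1 := by nlinarith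
      have h5 : δ ^ 2 / 8 * (q : ℝ) ^ L ≤ 1 * (q : ℝ) ^ L := by gcongr
      linarith
    exact_mod_cast h2
  refine ⟨T, L, L / (δ / 2) + K, hLn, fun D => ?_⟩
  set C := Nat.clog P (q ^ D) + T with hC
  set G := (Finset.range D).filter fun d => goodD P q g m H T d with hGd
  have hwsub : ∀ d ∈ G, win P q T d ⊆ Finset.range C := by
    intro d hd c hc
    rw [hGd, Finset.mem_filter, Finset.mem_range] at hd
    unfold win at hc
    rw [Finset.mem_Ico] at hc
    rw [Finset.mem_range, hC]
    have : Nat.clog P (q ^ d) ≤ Nat.clog P (q ^ D) :=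
      Nat.clog_mono_right _ (Nat.pow_le_pow_right (by omega) hd.1.le)
    omega
  set Y : ℕ → ℝ := fun d => (∑ c ∈ Finset.range C, (P : ℝ) ^ c * f) / (q : ℝ) ^ d with hY
  obtain ⟨B, hB, hle⟩ := second_moment (S := (Finset.range C).powerset)
    (Finset.powerset_nonempty _) D L G (Finset.filter_subset _ _) (δ / 2) (by positivity)
    (fun d B => Int.fract (Y d + ∑ c ∈ B, (g : ℝ) * (P : ℝ) ^ c / (q : ℝ) ^ d) - 1 / 2)
    (fun d B => saw_abs _) (by
      intro d hd d' hd' hdd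
      have hgd := (Finset.mem_filter.1 hd).2
      have hgd' := (Finset.mem_filter.1 hd').2
      have hdis : Disjoint (win P q T d) (win P q T d') := by
        rw [Finset.disjoint_left]
        intro c h1 h2
        unfold win at h1 h2
        rw [Finset.mem_Ico] at h1 h2
        have := clog_pair hP hq hLn hdd
        omega
      have := pair_bound (hwsub d hd) (hwsub d' hd') hdis
        (fun c => (g : ℝ) * (P : ℝ) ^ c / (q : ℝ) ^ d) (fun c => (g : ℝ) * (P : ℝ) ^ c / (q : ℝ) ^ d')
        (Y d) (Y d') (δ ^ 2 / 16) (δ ^ 2 / 8) (fun c => by positivity)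
        (win_small hP hq hL' (by positivity) hdd) (hwin T d hgd) (hwin T d' hgd')
      refine this.trans (le_of_eq ?_)
      ring)
  rw [Finset.mem_powerset] at hB
  refine ⟨B, ?_⟩
  simp_rw [nB_div P f g C q _ hB]
  rw [← Finset.sum_filter_add_sum_filter_not (Finset.range D) (fun d => goodD P q g m H T d)]
  refine (abs_add_le _ _).trans ?_
  have h2 : |∑ d ∈ (Finset.range D).filter (fun d => ¬ goodD P q g m H T d),
      (Int.fract (Y d + ∑ c ∈ B, (g : ℝ) * (P : ℝ) ^ c / (q : ℝ) ^ d) - 1 / 2)| ≤ δ / 2 * D + K := by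
    refine (Finset.abs_sum_le_sum_abs _ _).trans ?_
    refine (Finset.sum_le_sum fun d _ => (saw_abs _).trans (by norm_num : (1 / 2 : ℝ) ≤ 1)).trans ?_
    rw [Finset.sum_const, nsmul_eq_mul, mul_one]
    exact hbad D
  linarith

lemma construct {p q k r : ℕ} (hp : 2 ≤ p) (hq : 2 ≤ q) (hc : Nat.Coprime p q) (hk : 1 ≤ k)
    (hkr : k < r) (δ : ℝ) (hδ : 0 < δ) (hδ1 : δ ≤ 1) : ∃ T : ℕ, ∃ K : ℝ, ∀ D : ℕ, ∃ n : ℕ,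
      digitSum p n = k * (Nat.clog (p ^ r) (q ^ D) + T) ∧
      |(digitSum q n : ℝ) - ((q : ℝ) - 1) / 2 * D| ≤ δ * D + K := by
  have hP : 2 ≤ p ^ r := hp.trans (Nat.le_self_pow (by omega) p)
  have hq' : (2 : ℝ) ≤ q := by exact_mod_cast hq
  have hq0 : (0 : ℝ) < q := by linarith
  obtain ⟨T, L, K, hL, hD⟩ := good_sum (P := p ^ r) (q := q) (g := p - 1) (cellF p k) hP hq
    (Nat.Coprime.pow_left _ hc) (by omega) (δ / q) (by positivity)
    (by rw [div_le_one hq0]; linarith)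
  refine ⟨T, q * |K| + 1 + q * (L + 1), fun D => ?_⟩
  obtain ⟨B, hB⟩ := hD D
  obtain ⟨h1, h2⟩ := nB_prop hp hk hkr (Nat.clog (p ^ r) (q ^ D) + T) B
  set n := nB (p ^ r) (cellF p k) (p - 1) (Nat.clog (p ^ r) (q ^ D) + T) B with hn
  refine ⟨n, h1, ?_⟩
  have hlt : n < q ^ (D + L) := by
    refine h2.trans_le ?_
    calc (p ^ r) ^ (Nat.clog (p ^ r) (q ^ D) + T)
        = (p ^ r) ^ (Nat.clog (p ^ r) (q ^ D)) * (p ^ r) ^ T := pow_add _ _ _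
      _ ≤ (p ^ r * q ^ D) * (p ^ r) ^ T := Nat.mul_le_mul_right _ (clog_facts hP hq D).2
      _ = (p ^ r) ^ (T + 1) * q ^ D := by ring
      _ ≤ q ^ L * q ^ D := Nat.mul_le_mul_right _ hL
      _ = q ^ (D + L) := by ring
  have hs := ds_fract hq (D + L) n hlt
  set F : ℕ → ℝ := fun d => Int.fract ((n : ℝ) / (q : ℝ) ^ d) with hF
  have hF0 : F 0 = 0 := by simp [hF]
  have e1 : ∑ d ∈ Finset.range (D + L), F (d + 1) =
      ∑ d ∈ Finset.range D, F d + ∑ i ∈ Finset.range (L + 1), F (D + i) := by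
    rw [← Finset.sum_range_add, ← add_assoc, Finset.sum_range_succ', hF0, add_zero]
  have e2 : ∑ d ∈ Finset.range D, F d = ∑ d ∈ Finset.range D, (F d - 1 / 2) + D / 2 := by
    rw [Finset.sum_sub_distrib, Finset.sum_const, Finset.card_range, nsmul_eq_mul]; ring
  have hE0 : 0 ≤ ∑ i ∈ Finset.range (L + 1), F (D + i) :=
    Finset.sum_nonneg fun i _ => Int.fract_nonneg _
  have hE1 : ∑ i ∈ Finset.range (L + 1), F (D + i) ≤ L + 1 := by
    refine (Finset.sum_le_sum fun i _ => (Int.fract_lt_one _).le).trans ?_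
    simp
  have hA0 : 0 ≤ (n : ℝ) / (q : ℝ) ^ (D + L) := by positivity
  have hA1 : (n : ℝ) / (q : ℝ) ^ (D + L) ≤ 1 := by
    rw [div_le_one (by positivity)]; exact_mod_cast hlt.le
  change (digitSum q n : ℝ) = n / (q : ℝ) ^ (D + L) + ((q : ℝ) - 1) *
    ∑ d ∈ Finset.range (D + L), F (d + 1) at hs
  rw [e1, e2] at hs
  change |∑ d ∈ Finset.range D, (F d - 1 / 2)| ≤ δ / q * D + K at hB
  set S := ∑ d ∈ Finset.range D, (F d - 1 / 2) with hS
  set E := ∑ i ∈ Finset.range (L + 1), F (D + i) with hE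
  set A := (n : ℝ) / (q : ℝ) ^ (D + L) with hA
  have e3 : (digitSum q n : ℝ) - ((q : ℝ) - 1) / 2 * D = A + ((q : ℝ) - 1) * S + ((q : ℝ) - 1) * E := by
    rw [hs]; ring
  rw [e3]
  have b1 : |((q : ℝ) - 1) * S| ≤ δ * D + q * |K| := by
    rw [abs_mul, abs_of_nonneg (by linarith : (0 : ℝ) ≤ q - 1)]
    calc ((q : ℝ) - 1) * |S| ≤ q * |S| := by gcongr; linarith
      _ ≤ q * (δ / q * D + |K|) := by
        gcongr; exact hB.trans (by linarith [le_abs_self K])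
      _ = _ := by field_simp
  have b2 : ((q : ℝ) - 1) * E ≤ q * (L + 1) := by
    apply mul_le_mul _ hE1 hE0 hq0.le; linarith
  have b3 : 0 ≤ ((q : ℝ) - 1) * E := mul_nonneg (by linarith) hE0
  rw [abs_le] at b1 ⊢
  have : 0 ≤ (q : ℝ) * (L + 1) := by positivity
  constructor <;> linarith [b1.1, b1.2]

lemma clog_log {P q : ℕ} (hP : 2 ≤ P) (hq : 2 ≤ q) (D : ℕ) :
    D * (Real.log q / Real.log P) ≤ Nat.clog P (q ^ D) ∧
    (Nat.clog P (q ^ D) : ℝ) ≤ D * (Real.log q / Real.log P) + 1 := by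
  obtain ⟨h1, h2⟩ := clog_facts hP hq D
  have hP' : (2 : ℝ) ≤ P := by exact_mod_cast hP
  have hq' : (2 : ℝ) ≤ q := by exact_mod_cast hq
  have hlP : 0 < Real.log P := Real.log_pos (by linarith)
  have h1' : (q : ℝ) ^ D ≤ (P : ℝ) ^ (Nat.clog P (q ^ D)) := by exact_mod_cast h1
  have h2' : (P : ℝ) ^ (Nat.clog P (q ^ D)) ≤ P * (q : ℝ) ^ D := by exact_mod_cast h2
  have l1 := Real.log_le_log (by positivity) h1'
  have l2 := Real.log_le_log (by positivity) h2'
  rw [Real.log_mul (by positivity) (by positivity)] at l2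
  rw [Real.log_pow, Real.log_pow] at l1 l2
  constructor
  · rw [← mul_div_assoc, div_le_iff₀ hlP]; exact l1
  · rw [← mul_div_assoc, div_add_one hlP.ne', le_div_iff₀ hlP]; linarith

lemma ratio_rat {p q k r : ℕ} (hp : 2 ≤ p) (hq : 2 ≤ q) (hc : Nat.Coprime p q) (hk : 1 ≤ k)
    (hkr : k < r) (ε : ℝ) (hε : 0 < ε) : ∃ n : ℕ, 1 ≤ n ∧
    |(digitSum p n : ℝ) / (digitSum q n : ℝ) -
      (k : ℝ) / r * (2 * Real.log q / (((q : ℝ) - 1) * Real.log p))| < ε := by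
  have hP : 2 ≤ p ^ r := hp.trans (Nat.le_self_pow (by omega) p)
  have hp' : (2 : ℝ) ≤ p := by exact_mod_cast hp
  have hq' : (2 : ℝ) ≤ q := by exact_mod_cast hq
  have hr' : (0 : ℝ) < r := by exact_mod_cast (by omega : 0 < r)
  have hk' : (0 : ℝ) < k := by exact_mod_cast hk
  have hlp : 0 < Real.log p := Real.log_pos (by linarith)
  have hlq : 0 < Real.log q := Real.log_pos (by linarith)
  set ℓ : ℝ := Real.log q / Real.log ((p ^ r : ℕ) : ℝ) with hℓ
  have hℓe : ℓ = Real.log q / (r * Real.log p) := by rw [hℓ]; push_cast; rw [Real.log_pow]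
  have hℓ0 : 0 < ℓ := by rw [hℓe]; positivity
  set a : ℝ := k * ℓ with ha
  set b : ℝ := ((q : ℝ) - 1) / 2 with hb
  have hb0 : 0 < b := by rw [hb]; linarith
  have hab : (k : ℝ) / r * (2 * Real.log q / (((q : ℝ) - 1) * Real.log p)) = a / b := by
    rw [ha, hb, hℓe]
    have : (q : ℝ) - 1 ≠ 0 := by linarith
    field_simp
  rw [hab]
  have hcont : ContinuousAt (fun z : ℝ × ℝ => z.1 / z.2) (a, b) :=
    ContinuousAt.div continuousAt_fst continuousAt_snd hb0.ne'
  obtain ⟨η, hη, hball⟩ := Metric.continuousAt_iff.1 hcont ε hε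
  obtain ⟨T, K, hcon⟩ := construct hp hq hc hk hkr (min 1 (η / 2)) (by positivity) (min_le_left _ _)
  obtain ⟨D, hD⟩ := exists_nat_gt (max (max 1 (|K| / (η / 2))) (k * (1 + T) / η))
  rw [max_lt_iff, max_lt_iff] at hD
  obtain ⟨⟨hD1, hD2⟩, hD3⟩ := hD
  have hD0 : (0 : ℝ) < D := by linarith
  obtain ⟨n, hn1, hn2⟩ := hcon D
  obtain ⟨c1, c2⟩ := clog_log hP hq D
  rw [← hℓ] at c1 c2
  have hn1' : (digitSum p n : ℝ) = k * (Nat.clog (p ^ r) (q ^ D) + T) := by rw [hn1]; push_cast; ring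
  have hspos : (0 : ℝ) < digitSum p n := by
    rw [hn1']
    have : 0 < D * ℓ := by positivity
    have hT : (0 : ℝ) ≤ T := by positivity
    apply mul_pos hk'; linarith
  refine ⟨n, ?_, ?_⟩
  · rcases Nat.eq_zero_or_pos n with h0 | h0
    · rw [h0, ds_zero] at hspos; simp at hspos
    · exact h0
  · have hu : |(digitSum p n : ℝ) / D - a| < η := by
      rw [div_lt_iff₀ hη] at hD3
      have e : (digitSum p n : ℝ) / D - a = k * ((Nat.clog (p ^ r) (q ^ D) : ℝ) - D * ℓ + T) / D := by
        rw [hn1', ha]; field_simp; ring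
      have hT : (0 : ℝ) ≤ T := by positivity
      rw [e, abs_of_nonneg (by apply div_nonneg _ hD0.le; apply mul_nonneg hk'.le; linarith),
        div_lt_iff₀ hD0]
      have : (k : ℝ) * ((Nat.clog (p ^ r) (q ^ D) : ℝ) - D * ℓ + T) ≤ k * (1 + T) := by
        apply mul_le_mul_of_nonneg_left _ hk'.le; linarith
      linarith
    have hv : |(digitSum q n : ℝ) / D - b| < η := by
      rw [div_lt_iff₀ (by positivity)] at hD2
      have e : (digitSum q n : ℝ) / D - b = ((digitSum q n : ℝ) - b * D) / D := by field_simp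
      rw [e, abs_div, abs_of_pos hD0, div_lt_iff₀ hD0]
      have : min 1 (η / 2) * D ≤ η / 2 * D := mul_le_mul_of_nonneg_right (min_le_right _ _) hD0.le
      linarith [le_abs_self K]
    have := @hball ((digitSum p n : ℝ) / D, (digitSum q n : ℝ) / D) (by
      rw [Prod.dist_eq, max_lt_iff, Real.dist_eq, Real.dist_eq]; exact ⟨hu, hv⟩)
    rw [Real.dist_eq] at this
    simp only at this
    rwa [div_div_div_cancel_right₀ hD0.ne'] at this

lemma ratio_dense {p q : ℕ} (hp : 2 ≤ p) (hq : 2 ≤ q) (hc : Nat.Coprime p q) (y : ℝ) (hy : 0 < y)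
    (hy' : y < 2 * Real.log q / (((q : ℝ) - 1) * Real.log p)) (ε : ℝ) (hε : 0 < ε) :
    ∃ n : ℕ, 1 ≤ n ∧ |(digitSum p n : ℝ) / (digitSum q n : ℝ) - y| < ε := by
  set M := 2 * Real.log q / (((q : ℝ) - 1) * Real.log p) with hM
  have hM0 : 0 < M := hy.trans hy'
  have h1 : max 0 (y / M - ε / (2 * M)) < y / M := by
    rw [max_lt_iff]
    exact ⟨by positivity, by linarith [show 0 < ε / (2 * M) by positivity]⟩
  obtain ⟨t, ht1, ht2⟩ := exists_rat_btwn h1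
  rw [max_lt_iff] at ht1
  have ht0 : (0 : ℚ) < t := by exact_mod_cast ht1.1
  have htlt : (t : ℝ) < 1 := ht2.trans ((div_lt_one hM0).2 hy')
  have htlt' : t < 1 := by exact_mod_cast htlt
  have hnum : 0 < t.num := Rat.num_pos.2 ht0
  have hk : 1 ≤ t.num.toNat := by omega
  have hkr : t.num.toNat < t.den := by
    have := Rat.num_lt_denom_iff.2 htlt'
    omega
  obtain ⟨n, hn, hle⟩ := ratio_rat hp hq hc hk hkr (ε / 2) (by positivity)
  refine ⟨n, hn, ?_⟩
  have e : ((t.num.toNat : ℕ) : ℝ) / (t.den : ℝ) = t := by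
    have h3 : ((t.num.toNat : ℕ) : ℝ) = ((t.num : ℤ) : ℝ) := by
      exact_mod_cast congrArg (Int.cast (R := ℝ)) (Int.toNat_of_nonneg hnum.le)
    rw [h3, Rat.cast_def]
  rw [e, ← hM] at hle
  have h4 : |(t : ℝ) * M - y| ≤ ε / 2 := by
    have h5 : (t : ℝ) * M < y := (lt_div_iff₀ hM0).1 ht2
    have h6 : y - ε / 2 < t * M := by
      have : (y / M - ε / (2 * M)) * M < t * M := mul_lt_mul_of_pos_right ht1.2 hM0
      have e2 : (y / M - ε / (2 * M)) * M = y - ε / 2 := by field_simp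
      linarith
    rw [abs_le]; constructor <;> linarith
  have h7 := abs_sub_le ((digitSum p n : ℝ) / (digitSum q n : ℝ)) (t * M) y
  linarith

theorem stmt3 : ∀ x : ℝ, 0 < x → ∀ ε : ℝ, 0 < ε → ∃ n : ℕ, 1 ≤ n ∧
    |(digitSum 2 n : ℝ) / (digitSum 3 n : ℝ) - x| < ε := by
  intro x hx ε hε
  have l2 : 0 < Real.log 2 := Real.log_pos (by norm_num)
  have l23 : Real.log 2 < Real.log 3 := Real.log_lt_log (by norm_num) (by norm_num)
  by_cases h : x < Real.log 3 / Real.log 2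
  · refine ratio_dense (p := 2) (q := 3) le_rfl (by norm_num) (by norm_num) x hx ?_ ε hε
    refine h.trans_le (le_of_eq ?_)
    push_cast
    field_simp
    norm_num
  · push Not at h
    have hx1 : 1 < x := lt_of_lt_of_le ((one_lt_div l2).2 l23) h
    have hy : x⁻¹ < 2 * Real.log ((2 : ℕ) : ℝ) / ((((2 : ℕ) : ℝ) - 1) * Real.log ((3 : ℕ) : ℝ)) := by
      refine (inv_lt_one_of_one_lt₀ hx1).trans ?_
      push_cast
      rw [one_lt_div (by linarith)]
      have : Real.log 3 < Real.log (2 ^ 2) := Real.log_lt_log (by norm_num) (by norm_num)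
      rw [Real.log_pow] at this
      push_cast at this
      linarith
    have hcont : ContinuousAt (fun z : ℝ => z⁻¹) x⁻¹ := continuousAt_inv₀ (by positivity)
    obtain ⟨η, hη, hball⟩ := Metric.continuousAt_iff.1 hcont ε hε
    obtain ⟨n, hn, hle⟩ := ratio_dense (p := 3) (q := 2) (by norm_num) le_rfl (by norm_num) x⁻¹
      (by positivity) hy η hη
    refine ⟨n, hn, ?_⟩
    have := @hball _ (by rw [Real.dist_eq]; exact hle)
    rw [Real.dist_eq] at this
    simpa only [inv_inv, inv_div] using this
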